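/- arXiv:1812.08844 — 3 statements merged into one kernel-verified Lean document; each statement's English description precedes it below -/
import Mathlib

section
/- Let C be a closed bounded subset of E₁, let F : E → E be continuous, and let K ⊆ E be compact. Then the set {x ∈ C : Ax − F(ιx) ∈ K} is a compact subset of E₁. In particular, the map x ↦ Ax − F(ιx) is proper on closed bounded subsets of E₁. -/
open Filter Topology Bornology
open scoped RealInnerProductSpace

namespace HilbertBasis

variable {E : Type*} [NormedAddCommGroup E] [InnerProductSpace ℝ E]

/-- A coordinatewise bound between two vectors gives the same bound between their norms. -/
theorem norm_le_mul_norm_of_abs_repr_le {κ : Type*} (e : HilbertBasis κ ℝ E) {y z : E} {c : ℝ}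
    (hc : 0 ≤ c) (h : ∀ n, |e.repr y n| ≤ c * |e.repr z n|) : ‖y‖ ≤ c * ‖z‖ := by
  have parseval (v : E) : HasSum (fun n => e.repr v n ^ 2) (‖v‖ ^ 2) := by
    have := e.hasSum_inner_mul_inner v v
    simp only [real_inner_self_eq_norm_sq] at this
    have hcoord : (fun n => e.repr v n ^ 2) = fun n => ⟪v, e n⟫ * ⟪e n, v⟫ := by
      ext n
      rw [e.repr_apply_apply, sq, real_inner_comm]
    rwa [hcoord]
  have hsq : ‖y‖ ^ 2 ≤ c ^ 2 * ‖z‖ ^ 2 := by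
    refine hasSum_le (fun n => ?_) (parseval y) ((parseval z).mul_left (c ^ 2))
    rw [← sq_abs, ← sq_abs (e.repr z n), ← mul_pow]
    exact pow_le_pow_left₀ (abs_nonneg _) (h n) 2
  rw [← mul_pow] at hsq
  exact le_of_sq_le_sq hsq (by positivity)

theorem repr_tsum_smul {κ : Type*} (e : HilbertBasis κ ℝ E) {a : κ → ℝ}
    (ha : Summable fun n => a n ^ 2) (m : κ) : e.repr (∑' n, a n • e n) m = a m := by
  have hmem : Memℓp a 2 := by
    rw [memℓp_gen_iff (by norm_num)]
    simpa using ha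
  have hsum := (e.hasSum_repr_symm ⟨a, hmem⟩).tsum_eq
  rw [hsum, LinearIsometryEquiv.apply_symm_apply]

/-- The finite rank operator keeping the coordinates of index less than `N`. -/
noncomputable def truncation (e : HilbertBasis ℕ ℝ E) (N : ℕ) : E →L[ℝ] E :=
  ∑ n ∈ Finset.range N, (innerSL ℝ (e n)).smulRight (e n)

theorem repr_truncation (e : HilbertBasis ℕ ℝ E) (N : ℕ) (x : E) (m : ℕ) :
    e.repr (e.truncation N x) m = if m < N then e.repr x m else 0 := by
  classical
  have h := orthonormal_iff_ite.mp e.orthonormal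
  simp only [e.repr_apply_apply]
  simp [truncation, inner_sum, inner_smul_right, h]

theorem isCompactOperator_truncation (e : HilbertBasis ℕ ℝ E) (N : ℕ) :
    IsCompactOperator (e.truncation N) := by
  induction N with
  | zero => simpa [truncation] using isCompactOperator_zero
  | succ N ih =>
    have hsucc : e.truncation (N + 1) =
        e.truncation N + (innerSL ℝ (e N)).smulRight (e N) := Finset.sum_range_succ _ _
    rw [hsucc]
    refine ih.add ?_
    have hfunctional : IsCompactOperator (innerSL ℝ (e N)) :=
      isCompactOperator_of_locallyCompactSpace_dom _
    exact hfunctional.continuous_comp (g := fun t : ℝ => t • e N) (by fun_prop)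

/-- If the coordinates of `T x`, multiplied by weights tending to infinity, are those of a vector
of norm at most `‖x‖`, then `T` is a compact operator. -/
theorem isCompactOperator_of_repr_eq_mul [CompleteSpace E] (e : HilbertBasis ℕ ℝ E)
    {X : Type*} [NormedAddCommGroup X] [NormedSpace ℝ X] {lam : ℕ → ℝ}
    (hlam : Tendsto (fun n => |lam n|) atTop atTop) (T : X →L[ℝ] E) {B : X → E}
    (hB : ∀ x, ‖B x‖ ≤ ‖x‖) (hrepr : ∀ x n, e.repr (B x) n = lam n * e.repr (T x) n) :
    IsCompactOperator T := by
  refine isCompactOperator_of_tendsto (l := atTop) (F := fun N => (e.truncation N).comp T) ?_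
    (Eventually.of_forall fun N => (e.isCompactOperator_truncation N).comp_clm T)
  rw [Metric.tendsto_atTop]
  intro ε hε
  obtain ⟨N, hN⟩ := eventually_atTop.mp (hlam.eventually_ge_atTop (ε / 2)⁻¹)
  refine ⟨N, fun M hM => ?_⟩
  rw [dist_eq_norm]
  refine lt_of_le_of_lt ?_ (half_lt_self hε)
  refine ContinuousLinearMap.opNorm_le_bound _ (by positivity) fun x => ?_
  refine le_trans ?_ (mul_le_mul_of_nonneg_left (hB x) (by positivity))
  refine e.norm_le_mul_norm_of_abs_repr_le (by positivity) fun n => ?_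
  have hcoord : e.repr ((e.truncation M).comp T x - T x) n =
      (if n < M then e.repr (T x) n else 0) - e.repr (T x) n := by
    rw [map_sub, ← repr_truncation]
    rfl
  rw [sub_apply, hcoord]
  split_ifs with hn
  · simp only [sub_self, abs_zero]
    positivity
  · have hle := hN n (by omega)
    rw [zero_sub, abs_neg, hrepr, abs_mul, ← mul_assoc]
    refine le_mul_of_one_le_left (abs_nonneg _) ?_
    calc (1 : ℝ) = ε / 2 * (ε / 2)⁻¹ := (mul_inv_cancel₀ (by positivity)).symm
      _ ≤ ε / 2 * |lam n| := by gcongr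

end HilbertBasis

/-- The graph inner product identity yields the graph norm of a difference, without assuming that
`A` is linear. -/
theorem norm_sub_sq_of_graph_inner
    {E E₁ : Type*} [NormedAddCommGroup E] [InnerProductSpace ℝ E]
    [NormedAddCommGroup E₁] [InnerProductSpace ℝ E₁] (ι : E₁ →ₗ[ℝ] E) {A : E₁ → E}
    (hgraph : ∀ x y : E₁, ⟪x, y⟫ = ⟪ι x, ι y⟫ + ⟪A x, A y⟫) (x y : E₁) :
    ‖x - y‖ ^ 2 = ‖ι x - ι y‖ ^ 2 + ‖A x - A y‖ ^ 2 := by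
  have hx := hgraph x x
  have hy := hgraph y y
  have hxy := hgraph x y
  simp only [real_inner_self_eq_norm_sq] at hx hy
  rw [norm_sub_sq_real, norm_sub_sq_real, norm_sub_sq_real]
  linarith

/-- The graph map of an operator on a complete space with the graph norm is a closed embedding. -/
theorem isClosedEmbedding_of_graph_inner
    {E E₁ : Type*} [NormedAddCommGroup E] [InnerProductSpace ℝ E]
    [NormedAddCommGroup E₁] [InnerProductSpace ℝ E₁] [CompleteSpace E₁]
    (ι : E₁ →ₗ[ℝ] E) {A : E₁ → E}
    (hgraph : ∀ x y : E₁, ⟪x, y⟫ = ⟪ι x, ι y⟫ + ⟪A x, A y⟫) :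
    IsClosedEmbedding fun x => (ι x, A x) := by
  have hsub := norm_sub_sq_of_graph_inner ι hgraph
  have hanti : AntilipschitzWith 2 fun x => (ι x, A x) := by
    refine AntilipschitzWith.of_le_mul_dist fun x y => ?_
    rw [Prod.dist_eq, dist_eq_norm, dist_eq_norm, dist_eq_norm]
    have h₁ := le_max_left ‖ι x - ι y‖ ‖A x - A y‖
    have h₂ := le_max_right ‖ι x - ι y‖ ‖A x - A y‖
    have h₀ := (norm_nonneg _).trans h₁
    push_cast
    refine le_of_sq_le_sq ?_ (by positivity)
    rw [hsub]
    nlinarith [pow_le_pow_left₀ (norm_nonneg _) h₁ 2, pow_le_pow_left₀ (norm_nonneg _) h₂ 2]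
  have hlip : LipschitzWith 1 fun x => (ι x, A x) := by
    refine LipschitzWith.of_dist_le_mul fun x y => ?_
    rw [Prod.dist_eq, dist_eq_norm, dist_eq_norm, dist_eq_norm, NNReal.coe_one, one_mul]
    refine max_le ?_ ?_ <;> refine le_of_sq_le_sq ?_ (norm_nonneg _) <;> rw [hsub]
    · exact le_add_of_nonneg_right (sq_nonneg _)
    · exact le_add_of_nonneg_left (sq_nonneg _)
  exact hanti.isClosedEmbedding hlip.uniformContinuous

/-- Let `C` be a closed bounded subset of `E₁`, `F : E → E` continuous,
and `K ⊆ E` compact. Then `{x ∈ C : A x − F (ι x) ∈ K}` is a compact subset of `E₁`;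
i.e. the map `x ↦ A x − F (ι x)` is proper on closed bounded subsets of `E₁`. -/
theorem stmt_8
    {E : Type*} [NormedAddCommGroup E] [InnerProductSpace ℝ E] [CompleteSpace E]
    (e : HilbertBasis ℕ ℝ E) (lam : ℕ → ℝ)
    (hlam : Tendsto (fun n => |lam n|) atTop atTop)
    {E₁ : Type*} [NormedAddCommGroup E₁] [InnerProductSpace ℝ E₁] [CompleteSpace E₁]
    (ι : E₁ →ₗ[ℝ] E) (hι : Function.Injective ι)
    (hrange : Set.range ι = {x : E | Summable fun n => lam n ^ 2 * e.repr x n ^ 2})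
    (A : E₁ → E)
    (hA : ∀ x : E₁, A x = ∑' (n : ℕ), (lam n * e.repr (ι x) n) • e n)
    (hgraph : ∀ x y : E₁, ⟪x, y⟫ = ⟪ι x, ι y⟫ + ⟪A x, A y⟫)
    (F : E → E) (hF : Continuous F)
    (C : Set E₁) (hCclosed : IsClosed C) (hCbdd : IsBounded C)
    (K : Set E) (hK : IsCompact K) :
    IsCompact {x : E₁ | x ∈ C ∧ A x - F (ι x) ∈ K} := by
  have hemb := isClosedEmbedding_of_graph_inner ι hgraph
  have hcont := hemb.continuous
  have hιcont : Continuous ι := continuous_fst.comp hcont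
  have hAcont : Continuous A := continuous_snd.comp hcont
  have hrepr (x : E₁) (n : ℕ) : e.repr (A x) n = lam n * e.repr (ι x) n := by
    have hx : Summable fun n => lam n ^ 2 * e.repr (ι x) n ^ 2 := by
      have : ι x ∈ Set.range ι := ⟨x, rfl⟩
      rwa [hrange] at this
    rw [hA, e.repr_tsum_smul (a := fun n => lam n * e.repr (ι x) n)
      (by simpa only [mul_pow] using hx)]
  have hbound (x : E₁) : ‖A x‖ ≤ ‖x‖ := by
    have hx := hgraph x x
    simp only [real_inner_self_eq_norm_sq] at hx
    exact le_of_sq_le_sq (by linarith [sq_nonneg ‖ι x‖]) (norm_nonneg x)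
  have hcompact : IsCompactOperator ι :=
    e.isCompactOperator_of_repr_eq_mul hlam ⟨ι, hιcont⟩ hbound hrepr
  obtain ⟨Q, hQ, hCQ⟩ := hcompact.image_subset_compact_of_bounded hCbdd
  have himage : IsCompact ((fun p : E × E => (p.1, p.2 + F p.1)) '' (Q ×ˢ K)) :=
    (hQ.prod hK).image (by fun_prop)
  refine (hemb.isCompact_preimage himage).of_isClosed_subset ?_ ?_
  · exact hCclosed.inter (hK.isClosed.preimage (hAcont.sub (hF.comp hιcont)))
  · rintro x ⟨hxC, hxK⟩
    exact ⟨(ι x, A x - F (ι x)), ⟨hCQ ⟨x, hxC, rfl⟩, hxK⟩, by simp⟩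
end

section
/- Let W and U be open bounded subsets of E₁ with f⁻¹(0) ⊆ W ⊆ U ⊆ cl U ⊆ D_f. Then there exists ε > 0 such that ‖f(x)‖ ≥ 2ε for all x ∈ cl U \ W. -/
open Filter Topology Bornology
open scoped RealInnerProductSpace

/-- A vector whose coordinates are dominated by those of another one has smaller norm. -/
theorem HilbertBasis.norm_le_norm_of_abs_repr_le {ι E : Type*} [NormedAddCommGroup E]
    [InnerProductSpace ℝ E] (e : HilbertBasis ι ℝ E) {x y : E}
    (h : ∀ i, |e.repr x i| ≤ |e.repr y i|) : ‖x‖ ≤ ‖y‖ := by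
  rw [← e.repr.norm_map x, ← e.repr.norm_map y]
  exact lp.norm_mono two_ne_zero h

theorem HilbertBasis.ext_repr {ι E : Type*} [NormedAddCommGroup E]
    [InnerProductSpace ℝ E] (e : HilbertBasis ι ℝ E) {x y : E}
    (h : ∀ i, e.repr x i = e.repr y i) : x = y :=
  e.repr.injective (lp.ext (funext h))

/-- The sum of the series with square-summable coefficients `c` has coordinates `c`. -/
theorem HilbertBasis.repr_tsum_smul_s9 {ι E : Type*} [NormedAddCommGroup E]
    [InnerProductSpace ℝ E] (e : HilbertBasis ι ℝ E) {c : ι → ℝ}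
    (hc : Summable fun i => c i ^ 2) (i : ι) : e.repr (∑' j, c j • e j) i = c i := by
  have hmem : Memℓp c 2 := memℓp_gen (by simpa using hc)
  have hsum := (e.hasSum_repr_symm ⟨c, hmem⟩).tsum_eq
  have hval : ∑' j, c j • e j = e.repr.symm ⟨c, hmem⟩ := hsum
  rw [hval, LinearIsometryEquiv.apply_symm_apply]

/-- If `B` acts as `J` followed by a diagonal multiplication by coefficients tending to infinity,
then `J` is a compact operator. -/
theorem HilbertBasis.isCompactOperator_of_repr_eq_mul_s9 {E E₁ : Type*} [NormedAddCommGroup E]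
    [InnerProductSpace ℝ E] [CompleteSpace E] [NormedAddCommGroup E₁] [NormedSpace ℝ E₁]
    (e : HilbertBasis ℕ ℝ E) {lam : ℕ → ℝ} (hlam : Tendsto (fun n => |lam n|) atTop atTop)
    {J B : E₁ →L[ℝ] E} (hB : ∀ x n, e.repr (B x) n = lam n * e.repr (J x) n) :
    IsCompactOperator J := by
  let P : ℕ → E₁ →L[ℝ] E := fun N =>
    ∑ n ∈ Finset.range N, ((innerSL ℝ (e n)).comp J).smulRight (e n)
  have hP_repr (N : ℕ) (x : E₁) (n : ℕ) :
      e.repr (P N x) n = if n < N then e.repr (J x) n else 0 := by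
    rw [e.repr_apply_apply, e.repr_apply_apply]
    simp [P, inner_sum, inner_smul_right, orthonormal_iff_ite.mp e.orthonormal]
  refine isCompactOperator_of_tendsto (F := P) (l := atTop) ?_ (Eventually.of_forall fun N => ?_)
  · refine Metric.tendsto_atTop.mpr fun ε hε => ?_
    have hM : 0 < (‖B‖ + 1) / ε := by positivity
    obtain ⟨N₀, hN₀⟩ := eventually_atTop.mp (hlam.eventually_ge_atTop ((‖B‖ + 1) / ε))
    refine ⟨N₀, fun N hN => ?_⟩
    have hle : ‖P N - J‖ ≤ ((‖B‖ + 1) / ε)⁻¹ * ‖B‖ := by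
      refine ContinuousLinearMap.opNorm_le_bound _ (by positivity) fun x => ?_
      calc ‖(P N - J) x‖ ≤ ‖((‖B‖ + 1) / ε)⁻¹ • B x‖ := by
            refine e.norm_le_norm_of_abs_repr_le fun n => ?_
            simp only [_root_.sub_apply, map_sub, map_smul, lp.coeFn_sub,
              lp.coeFn_smul, Pi.sub_apply, Pi.smul_apply, smul_eq_mul, hP_repr, hB]
            split_ifs with hn
            · rw [sub_self, abs_zero]
              exact abs_nonneg _
            · rw [zero_sub, abs_neg, abs_mul, abs_mul, abs_of_pos (inv_pos.mpr hM), ← mul_assoc]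
              refine le_mul_of_one_le_left (abs_nonneg _) ?_
              exact (one_le_inv_mul₀ hM).mpr (hN₀ n (by omega))
        _ ≤ ((‖B‖ + 1) / ε)⁻¹ * ‖B‖ * ‖x‖ := by
            rw [norm_smul, Real.norm_of_nonneg (by positivity), mul_assoc]
            gcongr
            exact B.le_opNorm x
    rw [dist_eq_norm]
    refine hle.trans_lt ?_
    rw [inv_div, div_mul_eq_mul_div, div_lt_iff₀ (by positivity)]
    nlinarith
  · have hterm (n : ℕ) : IsCompactOperator (((innerSL ℝ (e n)).comp J).smulRight (e n)) :=
      (isCompactOperator_of_locallyCompactSpace_rng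
        (ContinuousLinearMap.toSpanSingleton ℝ (e n))).comp_clm ((innerSL ℝ (e n)).comp J)
    exact (compactOperator (RingHom.id ℝ) E₁ E).sum_mem
      (t := Finset.range N) (f := fun n => ((innerSL ℝ (e n)).comp J).smulRight (e n))
      fun n _ => hterm n

/-- Let `W` and `U` be open bounded subsets of `E₁` with
`f⁻¹(0) ⊆ W ⊆ U ⊆ cl U ⊆ D_f`, where `f x = A x − F (ι x)`. Then there exists
`ε > 0` such that `‖f x‖ ≥ 2ε` for all `x ∈ cl U \ W`. -/
theorem stmt_9
    {E : Type*} [NormedAddCommGroup E] [InnerProductSpace ℝ E] [CompleteSpace E]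
    (e : HilbertBasis ℕ ℝ E) (lam : ℕ → ℝ)
    (hlam : Tendsto (fun n => |lam n|) atTop atTop)
    {E₁ : Type*} [NormedAddCommGroup E₁] [InnerProductSpace ℝ E₁] [CompleteSpace E₁]
    (ι : E₁ →ₗ[ℝ] E) (hι : Function.Injective ι)
    (hrange : Set.range ι = {x : E | Summable fun n => lam n ^ 2 * e.repr x n ^ 2})
    (A : E₁ → E)
    (hA : ∀ x : E₁, A x = ∑' (n : ℕ), (lam n * e.repr (ι x) n) • e n)
    (hgraph : ∀ x y : E₁, ⟪x, y⟫ = ⟪ι x, ι y⟫ + ⟪A x, A y⟫)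
    (F : E → E) (hF : Continuous F)
    (Df : Set E₁) (hDf : IsOpen Df)
    (hzc : IsCompact {x : E₁ | x ∈ Df ∧ A x - F (ι x) = 0})
    (W U : Set E₁)
    (hWopen : IsOpen W) (hWbdd : IsBounded W)
    (hUopen : IsOpen U) (hUbdd : IsBounded U)
    (hzW : {x : E₁ | x ∈ Df ∧ A x - F (ι x) = 0} ⊆ W)
    (hWU : W ⊆ U) (hclU : closure U ⊆ Df) :
    ∃ ε > 0, ∀ x ∈ closure U \ W, 2 * ε ≤ ‖A x - F (ι x)‖ := by
  have hA_repr (x : E₁) (n : ℕ) : e.repr (A x) n = lam n * e.repr (ι x) n := by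
    have hx : Summable fun n => lam n ^ 2 * e.repr (ι x) n ^ 2 :=
      hrange.subset (Set.mem_range_self x)
    rw [hA]
    exact e.repr_tsum_smul_s9 (c := fun n => lam n * e.repr (ι x) n)
      (by simpa only [mul_pow] using hx) n
  have hnorm (x : E₁) : ‖x‖ ^ 2 = ‖ι x‖ ^ 2 + ‖A x‖ ^ 2 := by
    simpa only [real_inner_self_eq_norm_sq] using hgraph x x
  have hιle (x : E₁) : ‖ι x‖ ≤ 1 * ‖x‖ := by
    rw [one_mul]
    exact le_of_sq_le_sq (by nlinarith [hnorm x, sq_nonneg ‖A x‖]) (norm_nonneg x)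
  have hAle (x : E₁) : ‖A x‖ ≤ 1 * ‖x‖ := by
    rw [one_mul]
    exact le_of_sq_le_sq (by nlinarith [hnorm x, sq_nonneg ‖ι x‖]) (norm_nonneg x)
  let J : E₁ →L[ℝ] E := ι.mkContinuous 1 hιle
  let B : E₁ →L[ℝ] E := LinearMap.mkContinuous
    { toFun := A
      map_add' := fun x y => e.ext_repr fun n => by simp [hA_repr, mul_add]
      map_smul' := fun c x => e.ext_repr fun n => by simp [hA_repr, mul_left_comm] } 1 hAle
  have hJ : IsCompactOperator J :=
    e.isCompactOperator_of_repr_eq_mul_s9 (B := B) hlam hA_repr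
  have hf_cont : Continuous fun x => A x - F (ι x) := B.continuous.sub (hF.comp J.continuous)
  by_contra! hcon
  choose x hxmem hx using fun k : ℕ => hcon (1 / ((k : ℝ) + 1)) Nat.one_div_pos_of_nat
  have hf_lim : Tendsto (fun k => A (x k) - F (ι (x k))) atTop (𝓝 0) := by
    refine squeeze_zero_norm (fun k => (hx k).le) ?_
    simpa using (tendsto_one_div_add_atTop_nhds_zero_nat (𝕜 := ℝ)).const_mul 2
  obtain ⟨K, hK, hUK⟩ :=
    IsCompactOperator.image_subset_compact_of_bounded (f := (J : E₁ →ₗ[ℝ] E)) hJ hUbdd.closure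
  obtain ⟨y, -, φ, hφ, hy⟩ := hK.tendsto_subseq fun k => hUK ⟨x k, (hxmem k).1, rfl⟩
  replace hy : Tendsto (fun k => ι (x (φ k))) atTop (𝓝 y) := hy
  have hAy : Tendsto (fun k => A (x (φ k))) atTop (𝓝 (F y)) := by
    simpa using (hf_lim.comp hφ.tendsto_atTop).add ((hF.tendsto y).comp hy)
  have hcauchy : CauchySeq fun k => x (φ k) := by
    rw [Metric.cauchySeq_iff]
    intro ε hε
    obtain ⟨N₁, hN₁⟩ := Metric.cauchySeq_iff.mp hy.cauchySeq (ε / 2) (half_pos hε)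
    obtain ⟨N₂, hN₂⟩ := Metric.cauchySeq_iff.mp hAy.cauchySeq (ε / 2) (half_pos hε)
    refine ⟨max N₁ N₂, fun m hm n hn => ?_⟩
    have h₁ := hN₁ m (le_of_max_le_left hm) n (le_of_max_le_left hn)
    have h₂ := hN₂ m (le_of_max_le_right hm) n (le_of_max_le_right hn)
    have hsub : A (x (φ m) - x (φ n)) = A (x (φ m)) - A (x (φ n)) := map_sub B _ _
    rw [dist_eq_norm] at h₁ h₂ ⊢
    rw [← map_sub] at h₁
    rw [← hsub] at h₂
    refine lt_of_pow_lt_pow_left₀ 2 hε.le ?_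
    rw [hnorm]
    nlinarith [norm_nonneg (ι (x (φ m) - x (φ n))), norm_nonneg (A (x (φ m) - x (φ n)))]
  obtain ⟨z, hz⟩ := cauchySeq_tendsto_of_complete hcauchy
  have hzmem : z ∈ closure U \ W :=
    (isClosed_closure.sdiff hWopen).mem_of_tendsto hz (Eventually.of_forall fun k => hxmem (φ k))
  have hfz : A z - F (ι z) = 0 :=
    tendsto_nhds_unique ((hf_cont.tendsto z).comp hz) (hf_lim.comp hφ.tendsto_atTop)
  exact hzmem.2 (hzW ⟨hclU hzmem.1, hfz⟩)
end

section
/- Define h̃ₙ : Λ → E by h̃ₙ(t,x) = Ax − PₙF(t, ιx). Let W be an open bounded subset of [0,1] × E₁ with cl W ⊆ Λ. Then for every ε > 0 there exists N such that for all n ≥ N and all (t,x) ∈ cl W, ‖h(t,x) − h̃ₙ(t,x)‖ < ε. -/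
open Filter Topology Bornology
open scoped RealInnerProductSpace

/-- The orthogonal projection `Pₙ : E → Vₙ` onto `Vₙ = span {e k : |λ k| ≤ n}`,
given by `Pₙ x = ∑_{|λ k| ≤ n} ⟪x, e k⟫ e k`. -/
noncomputable def projP {E : Type*} [NormedAddCommGroup E] [InnerProductSpace ℝ E]
    (e : HilbertBasis ℕ ℝ E) (lam : ℕ → ℝ) (n : ℕ) (x : E) : E :=
  ∑' k : {k : ℕ // |lam k| ≤ (n : ℝ)}, e.repr x (k : ℕ) • e (k : ℕ)

theorem finite_setOf_abs_le {lam : ℕ → ℝ} (hlam : Tendsto (fun n => |lam n|) atTop atTop)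
    (r : ℝ) : {k : ℕ | |lam k| ≤ r}.Finite := by
  have h := hlam.eventually_gt_atTop r
  rw [← Nat.cofinite_eq_atTop, Filter.eventually_cofinite] at h
  simpa using h

section Projection

variable {E : Type*} [NormedAddCommGroup E] [InnerProductSpace ℝ E]

theorem HilbertBasis.hasSum_repr_sq (e : HilbertBasis ℕ ℝ E) (u : E) :
    HasSum (fun k => e.repr u k ^ 2) (‖u‖ ^ 2) := by
  have h := lp.hasSum_norm (p := 2) (by norm_num) (e.repr u)
  simpa using h

theorem HilbertBasis.norm_le_of_abs_repr_le (e : HilbertBasis ℕ ℝ E) {u v : E}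
    (h : ∀ k, |e.repr u k| ≤ |e.repr v k|) : ‖u‖ ≤ ‖v‖ := by
  refine le_of_sq_le_sq ?_ (norm_nonneg v)
  exact hasSum_le (fun k => sq_le_sq.2 (h k)) (e.hasSum_repr_sq u) (e.hasSum_repr_sq v)

theorem HilbertBasis.abs_repr_le_norm (e : HilbertBasis ℕ ℝ E) (u : E) (k : ℕ) :
    |e.repr u k| ≤ ‖u‖ := by
  have h := lp.norm_apply_le_norm (p := 2) (by norm_num) (e.repr u) k
  simpa using h

/-- For a square-summable `a`, the vector `∑ a k • e k` has coordinates `a`. -/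
theorem HilbertBasis.repr_tsum_smul_s13 (e : HilbertBasis ℕ ℝ E) {a : ℕ → ℝ}
    (ha : Summable fun k => a k ^ 2) (k : ℕ) : e.repr (∑' n, a n • e n) k = a k := by
  have hmem : Memℓp a 2 := by
    refine memℓp_gen ?_
    simpa using ha
  let b : lp (fun _ : ℕ => ℝ) 2 := ⟨a, hmem⟩
  have hb : ∑' n, a n • e n = e.repr.symm b := (e.hasSum_repr_symm b).tsum_eq
  rw [hb, LinearIsometryEquiv.apply_symm_apply]

theorem projP_eq_sum (e : HilbertBasis ℕ ℝ E) {lam : ℕ → ℝ} {n : ℕ}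
    (hfin : {k : ℕ | |lam k| ≤ (n : ℝ)}.Finite) (x : E) :
    projP e lam n x = ∑ k ∈ hfin.toFinset, e.repr x k • e k := by
  rw [← Finset.tsum_subtype]
  unfold projP
  exact (Equiv.subtypeEquivRight (by simp)).tsum_eq
    (fun k : {k // k ∈ hfin.toFinset} => e.repr x (k : ℕ) • e (k : ℕ))

theorem repr_projP (e : HilbertBasis ℕ ℝ E) {lam : ℕ → ℝ} {n : ℕ}
    (hfin : {k : ℕ | |lam k| ≤ (n : ℝ)}.Finite) (x : E) (k : ℕ) :
    e.repr (projP e lam n x) k = if |lam k| ≤ (n : ℝ) then e.repr x k else 0 := by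
  classical
  have h : ∀ j, e.repr (e j) k = if j = k then 1 else 0 := fun j => by
    rw [e.repr_self, lp.single_apply]
    by_cases hjk : j = k
    · subst hjk; simp
    · simp [hjk, Ne.symm hjk]
  rw [projP_eq_sum e hfin, map_sum, lp.coeFn_sum, Finset.sum_apply]
  simp [h]

theorem projP_sub (e : HilbertBasis ℕ ℝ E) {lam : ℕ → ℝ} {n : ℕ}
    (hfin : {k : ℕ | |lam k| ≤ (n : ℝ)}.Finite) (x y : E) :
    projP e lam n (x - y) = projP e lam n x - projP e lam n y := by
  simp [projP_eq_sum e hfin, sub_smul]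

theorem norm_sub_projP_le (e : HilbertBasis ℕ ℝ E) {lam : ℕ → ℝ} {n : ℕ}
    (hfin : {k : ℕ | |lam k| ≤ (n : ℝ)}.Finite) (x : E) :
    ‖x - projP e lam n x‖ ≤ ‖x‖ := by
  refine e.norm_le_of_abs_repr_le fun k => ?_
  rw [map_sub, lp.coeFn_sub, Pi.sub_apply, repr_projP e hfin]
  split_ifs <;> simp

theorem mul_norm_sub_projP_le (e : HilbertBasis ℕ ℝ E) {lam : ℕ → ℝ} {n : ℕ}
    (hfin : {k : ℕ | |lam k| ≤ (n : ℝ)}.Finite) {x y : E}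
    (hy : ∀ k, e.repr y k = lam k * e.repr x k) :
    n * ‖x - projP e lam n x‖ ≤ ‖y‖ := by
  have h : ‖(n : ℝ) • (x - projP e lam n x)‖ ≤ ‖y‖ := by
    refine e.norm_le_of_abs_repr_le fun k => ?_
    rw [map_smul, map_sub, lp.coeFn_smul, lp.coeFn_sub, Pi.smul_apply, Pi.sub_apply,
      repr_projP e hfin, hy, smul_eq_mul, abs_mul, abs_mul, Nat.abs_cast]
    split_ifs with hk
    · simp only [sub_self, abs_zero, mul_zero]
      positivity
    · rw [sub_zero]
      exact mul_le_mul_of_nonneg_right (not_le.1 hk).le (abs_nonneg _)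
  simpa [norm_smul] using h

theorem tendsto_projP (e : HilbertBasis ℕ ℝ E) {lam : ℕ → ℝ}
    (hfin : ∀ r : ℝ, {k : ℕ | |lam k| ≤ r}.Finite) (x : E) :
    Tendsto (fun n => projP e lam n x) atTop (𝓝 x) := by
  have hs : Tendsto (fun n : ℕ => (hfin n).toFinset) atTop atTop := by
    refine tendsto_atTop_finset_of_monotone (fun m n hmn k hk => ?_) fun k => ?_
    · simp only [Set.Finite.mem_toFinset, Set.mem_ofPred_eq] at hk ⊢
      exact hk.trans (by exact_mod_cast hmn)
    · simpa using exists_nat_ge |lam k|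
  refine ((e.hasSum_repr x).comp hs).congr fun n => ?_
  simp [projP_eq_sum e (hfin n)]

/-- The projections `Pₙ` converge to the identity uniformly on totally bounded sets. -/
theorem TotallyBounded.eventually_norm_sub_projP_lt (e : HilbertBasis ℕ ℝ E) {lam : ℕ → ℝ}
    (hfin : ∀ r : ℝ, {k : ℕ | |lam k| ≤ r}.Finite) {K : Set E} (hK : TotallyBounded K)
    {ε : ℝ} (hε : 0 < ε) : ∀ᶠ n in atTop, ∀ z ∈ K, ‖z - projP e lam n z‖ < ε := by
  obtain ⟨t, ht, hKt⟩ := Metric.totallyBounded_iff.1 hK (ε / 2) (half_pos hε)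
  have h : ∀ᶠ n in atTop, ∀ y ∈ t, ‖y - projP e lam n y‖ < ε / 2 := by
    refine (Filter.eventually_all_finite ht).2 fun y _ => ?_
    have := Metric.tendsto_nhds.1 (tendsto_projP e hfin y) (ε / 2) (half_pos hε)
    simpa only [dist_eq_norm, norm_sub_rev] using this
  filter_upwards [h] with n hn z hz
  obtain ⟨y, hy, hzy⟩ := Set.mem_iUnion₂.1 (hKt hz)
  rw [Metric.mem_ball, dist_eq_norm] at hzy
  calc ‖z - projP e lam n z‖
      = ‖((z - y) - projP e lam n (z - y)) + (y - projP e lam n y)‖ := by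
        rw [projP_sub e (hfin n)]; congr 1; abel
    _ ≤ ‖(z - y) - projP e lam n (z - y)‖ + ‖y - projP e lam n y‖ := norm_add_le _ _
    _ < ε := by linarith [norm_sub_projP_le e (hfin n) (z - y), hn y hy]

/-- A set bounded in the graph norm of the diagonal operator with coefficients `lam` is totally
bounded (Rellich). -/
theorem totallyBounded_graph_ball (e : HilbertBasis ℕ ℝ E) {lam : ℕ → ℝ}
    (hfin : ∀ r : ℝ, {k : ℕ | |lam k| ≤ r}.Finite) (C : ℝ) :
    TotallyBounded {x : E | ‖x‖ ≤ C ∧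
      ∃ y : E, ‖y‖ ≤ C ∧ ∀ k, e.repr y k = lam k * e.repr x k} := by
  refine Metric.totallyBounded_iff.2 fun ε hε => ?_
  obtain ⟨n, hn⟩ := exists_nat_gt (C / (ε / 2))
  rw [div_lt_iff₀ (half_pos hε)] at hn
  have hT : IsCompact ((fun c : ℕ → ℝ => ∑ k ∈ (hfin n).toFinset, c k • e k) ''
      Set.univ.pi fun _ => Set.Icc (-C) C) :=
    (isCompact_univ_pi fun _ => isCompact_Icc).image (by fun_prop)
  obtain ⟨t, ht, hTt⟩ := Metric.totallyBounded_iff.1 hT.totallyBounded (ε / 2) (half_pos hε)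
  refine ⟨t, ht, fun x ⟨hx, y, hy, hxy⟩ => ?_⟩
  have hPx : projP e lam n x ∈ (fun c : ℕ → ℝ => ∑ k ∈ (hfin n).toFinset, c k • e k) ''
      Set.univ.pi fun _ => Set.Icc (-C) C :=
    ⟨e.repr x, fun k _ => abs_le.1 ((e.abs_repr_le_norm x k).trans hx),
      (projP_eq_sum e (hfin n) x).symm⟩
  obtain ⟨z, hz, hxz⟩ := Set.mem_iUnion₂.1 (hTt hPx)
  refine Set.mem_iUnion₂.2 ⟨z, hz, ?_⟩
  have hclose : ‖x - projP e lam n x‖ < ε / 2 :=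
    lt_of_mul_lt_mul_left
      (((mul_norm_sub_projP_le e (hfin n) hxy).trans hy).trans_lt hn) n.cast_nonneg
  rw [Metric.mem_ball] at hxz ⊢
  rw [← dist_eq_norm] at hclose
  linarith [dist_triangle x (projP e lam n x) z]

end Projection

/-- Define `h̃ₙ : Λ → E` by `h̃ₙ (t,x) = A x − Pₙ F (t, ι x)`. Let `W`
be an open bounded subset of `[0,1] × E₁` with `cl W ⊆ Λ`. Then for every `ε > 0` there
exists `N` such that for all `n ≥ N` and all `(t,x) ∈ cl W`,
`‖h (t,x) − h̃ₙ (t,x)‖ < ε`. -/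
theorem stmt_13
    {E : Type*} [NormedAddCommGroup E] [InnerProductSpace ℝ E] [CompleteSpace E]
    (e : HilbertBasis ℕ ℝ E) (lam : ℕ → ℝ)
    (hlam : Tendsto (fun n => |lam n|) atTop atTop)
    {E₁ : Type*} [NormedAddCommGroup E₁] [InnerProductSpace ℝ E₁] [CompleteSpace E₁]
    (ι : E₁ →ₗ[ℝ] E) (hι : Function.Injective ι)
    (hrange : Set.range ι = {x : E | Summable fun n => lam n ^ 2 * e.repr x n ^ 2})
    (A : E₁ → E)
    (hA : ∀ x : E₁, A x = ∑' (n : ℕ), (lam n * e.repr (ι x) n) • e n)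
    (hgraph : ∀ x y : E₁, ⟪x, y⟫ = ⟪ι x, ι y⟫ + ⟪A x, A y⟫)
    (F : unitInterval × E → E) (hF : Continuous F)
    (Λ : Set (unitInterval × E₁)) (hΛ : IsOpen Λ)
    (hzc : IsCompact {p : unitInterval × E₁ | p ∈ Λ ∧ A p.2 - F (p.1, ι p.2) = 0})
    (W : Set (unitInterval × E₁)) (hWopen : IsOpen W) (hWbdd : IsBounded W)
    (hclW : closure W ⊆ Λ) :
    ∀ ε > 0, ∃ N : ℕ, ∀ n ≥ N, ∀ p ∈ closure W,
      ‖(A p.2 - F (p.1, ι p.2)) - (A p.2 - projP e lam n (F (p.1, ι p.2)))‖ < ε := by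
  intro ε hε
  have hfin := finite_setOf_abs_le hlam
  obtain ⟨C, hC⟩ := isBounded_iff_forall_norm_le.1
    (LipschitzWith.prod_snd.isBounded_image hWbdd.closure)
  have hcpt := (totallyBounded_graph_ball e hfin C).closure.isCompact_of_isClosed isClosed_closure
  have hFcpt := (isCompact_univ (X := unitInterval)).prod hcpt |>.image hF
  obtain ⟨N, hN⟩ := eventually_atTop.1
    (hFcpt.totallyBounded.eventually_norm_sub_projP_lt e hfin hε)
  refine ⟨N, fun n hn p hp => ?_⟩
  rw [sub_sub_sub_cancel_left, norm_sub_rev]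
  refine hN n hn _ ⟨(p.1, ι p.2), ⟨Set.mem_univ _, subset_closure ?_⟩, rfl⟩
  have hpC : ‖p.2‖ ≤ C := hC _ ⟨p, hp, rfl⟩
  have hnorm : ‖p.2‖ ^ 2 = ‖ι p.2‖ ^ 2 + ‖A p.2‖ ^ 2 := by
    simpa only [real_inner_self_eq_norm_sq] using hgraph p.2 p.2
  have hsum : Summable fun k => (lam k * e.repr (ι p.2) k) ^ 2 := by
    have h : ι p.2 ∈ Set.range ι := ⟨_, rfl⟩
    rw [hrange] at h
    simpa only [mul_pow, Set.mem_ofPred_eq] using h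
  refine ⟨le_trans (le_of_sq_le_sq ?_ (norm_nonneg _)) hpC, A p.2,
    le_trans (le_of_sq_le_sq ?_ (norm_nonneg _)) hpC, fun k => ?_⟩
  · linarith [sq_nonneg ‖A p.2‖]
  · linarith [sq_nonneg ‖ι p.2‖]
  · rw [hA, e.repr_tsum_smul_s13 hsum]
end
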